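/- arXiv:2103.09997 — 3 statements merged into one kernel-verified Lean document; each statement's English description precedes it below -/
import Mathlib

section
/- The supremum of |Θ(θ₀,…,θ₆)| over all 7-tuples (θ₀,…,θ₆) of points of T³ = S¹×S¹×S¹ equals 11/45, and this supremum is attained, i.e. 11/45 is the maximum value of |Θ|. -/
open scoped BigOperators
open scoped Classical

noncomputable section

instance : Fact ((0:ℝ) < 1) := ⟨one_pos⟩

/-- The circle `ℝ/ℤ` with its standard circular order. -/
abbrev S1 : Type := AddCircle (1 : ℝ)

/-- The 3-torus `S¹ × S¹ × S¹`. -/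
abbrev T3 : Type := S1 × S1 × S1

/-- The orientation cocycle on the circle: `1` if `(a,b,c)` are pairwise distinct and
positively oriented, `-1` if pairwise distinct and negatively oriented, `0` otherwise. -/
noncomputable def OrS1 (a b c : S1) : ℝ :=
  if sbtw a b c then 1 else if sbtw c b a then -1 else 0

/-- The cocycle `Θ` on `(T³)⁷`. -/
noncomputable def Theta (θ : Fin 7 → T3) : ℝ :=
  (1 / (Nat.factorial 7 : ℝ)) * ∑ σ : Equiv.Perm (Fin 7),
    ((Equiv.Perm.sign σ : ℤ) : ℝ) *
      (OrS1 (θ (σ 0)).1 (θ (σ 1)).1 (θ (σ 2)).1 *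
       OrS1 (θ (σ 2)).2.1 (θ (σ 3)).2.1 (θ (σ 4)).2.1 *
       OrS1 (θ (σ 4)).2.2 (θ (σ 5)).2.2 (θ (σ 6)).2.2)

/-- The value of `f` along a list, read as the digits of a number in base `B`. -/
def packDigits {α : Type*} (B : ℕ) (f : α → ℕ) : List α → ℕ
  | [] => 0
  | a :: t => f a + B * packDigits B f t

lemma packDigits_add {α : Type*} (B : ℕ) (f g : α → ℕ) (l : List α) :
    packDigits B (fun a => f a + g a) l = packDigits B f l + packDigits B g l := by
  induction l with
  | nil => rfl
  | cons a t ih => simp only [packDigits, ih]; ring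

lemma packDigits_const_mul {α : Type*} (B c : ℕ) (f : α → ℕ) (l : List α) :
    packDigits B (fun a => c * f a) l = c * packDigits B f l := by
  induction l with
  | nil => rfl
  | cons a t ih => simp only [packDigits, ih]; ring

lemma packDigits_zero {α : Type*} (B : ℕ) (l : List α) :
    packDigits B (fun _ => 0) l = 0 := by
  induction l with
  | nil => rfl
  | cons a t ih => simp [packDigits, ih]

lemma sum_map_packDigits {α β : Type*} (B : ℕ) (f : β → α → ℕ) (m : List β) (l : List α) :
    (m.map fun b => packDigits B (f b) l).sum =
      packDigits B (fun a => (m.map fun b => f b a).sum) l := by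
  induction m with
  | nil => simp [packDigits_zero]
  | cons b t ih => simp [ih, packDigits_add]

/-- If adding `c` to every base-`256` digit leaves all the top bits clear, then every digit is
less than `128 - c`. -/
lemma lt_of_land_packDigits_eq_zero {α : Type*} (c : ℕ) (f : α → ℕ) (l : List α)
    (hf : ∀ a ∈ l, f a + c < 256)
    (h : (packDigits 256 f l + c * packDigits 256 (fun _ => 1) l) &&&
      (128 * packDigits 256 (fun _ => 1) l) = 0) :
    ∀ a ∈ l, f a + c < 128 := by
  rw [← packDigits_const_mul, ← packDigits_const_mul, ← packDigits_add] at h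
  induction l with
  | nil => simp
  | cons a t ih =>
    simp only [packDigits, mul_one] at h ih
    have ha := hf a (by simp)
    have h1 := congrArg (· / 2 ^ 8) h
    have h2 := congrArg (· % 2 ^ 8) h
    simp only [Nat.and_div_two_pow, Nat.and_mod_two_pow] at h1 h2
    have e1 : ∀ x y : ℕ, x < 256 → (x + 256 * y) / 2 ^ 8 = y := by omega
    have e2 : ∀ x y : ℕ, x < 256 → (x + 256 * y) % 2 ^ 8 = x := by omega
    rw [e1 _ _ ha, e1 _ _ (by norm_num)] at h1
    rw [e2 _ _ ha, e2 _ _ (by norm_num)] at h2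
    have e3 : ∀ x < 256, x &&& 128 = 0 → x < 128 := by decide +kernel
    simp only [List.mem_cons, forall_eq_or_imp]
    exact ⟨e3 _ ha h2, ih (fun b hb => hf b (by simp [hb])) (by simpa using h1)⟩

/-- All orderings of `0, …, 5`. -/
def orderings : List (List ℕ) := [0, 1, 2, 3, 4, 5].permutations'

/-- Whether the `i`-th entry of `l` is smaller than the `j`-th one, as a number. -/
def entryLT (l : List ℕ) (i j : ℕ) : ℕ := bif (l.getD i 0).blt (l.getD j 0) then 1 else 0

/-- Whether a list has an even number of inversions. -/
def evenInversions : List ℕ → Bool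
  | [] => true
  | a :: t => t.foldr (fun b r => xor (b.blt a) r) (evenInversions t)

/-- The even orderings of `0, …, 5` whose first two entries are increasing. -/
def evenOrderings : List (List ℕ) := orderings.filter fun e => match e with
  | [a, b, c, d, e, f] => a.blt b && evenInversions [a, b, c, d, e, f]
  | _ => false

/-- The summand of `agreement` indexed by an even ordering. -/
def agreementTerm (l m : List ℕ) : List ℕ → ℕ
  | [_, _, c, d, e, f] => entryLT l c d * entryLT m e f
  | _ => 0

/-- The number of even orderings `e` of `0, …, 5` with `e₀ < e₁`, for which `l` increases from
`e₂` to `e₃` and `m` increases from `e₄` to `e₅`. -/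
def agreement (l m : List ℕ) : ℕ := (evenOrderings.map (agreementTerm l m)).sum

/-- The numbers `entryLT m i j` for all orderings `m`, packed. -/
def packedEntryLT (i j : ℕ) : ℕ := packDigits 256 (fun m => entryLT m i j) orderings

/-- The coefficient of `entryLT l i j` in `agreement l m` for all orderings `m`, packed. -/
def packedCoeff (i j : ℕ) : ℕ := (evenOrderings.map fun e => match e with
  | [_, _, c, d, e, f] => bif c.beq i && d.beq j then packedEntryLT e f else 0
  | _ => 0).sum

/-- The numbers `agreement l m` for all orderings `m`, packed. -/
def packedAgreement (l : List ℕ) : ℕ :=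
  ([0, 1, 2, 3, 4, 5].map fun i =>
    ([0, 1, 2, 3, 4, 5].map fun j => entryLT l i j * packedCoeff i j).sum).sum

/-- The number all of whose base-`256` digits are `1`. -/
def packedOnes : ℕ := packDigits 256 (fun _ => 1) orderings

set_option maxRecDepth 100000 in
lemma packedAgreement_land :
    ∀ l ∈ orderings, (packedAgreement l + 71 * packedOnes) &&& (128 * packedOnes) = 0 := by
  decide +kernel

set_option maxRecDepth 100000 in
lemma length_evenOrderings : evenOrderings.length = 180 := by decide +kernel

attribute [irreducible] orderings evenOrderings

lemma blt_eq_decide (a b : ℕ) : a.blt b = decide (a < b) := by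
  by_cases h : a < b <;> simp [h, Nat.blt_eq, ← Bool.not_eq_true]

lemma natBeq_eq_decide (a b : ℕ) : a.beq b = decide (a = b) := by
  by_cases h : a = b <;> simp [h, Nat.beq_eq, ← Bool.not_eq_true]

lemma exists_eq_of_mem_evenOrderings {e : List ℕ} (he : e ∈ evenOrderings) :
    ∃ a b c d e₄ e₅, e = [a, b, c, d, e₄, e₅] ∧ c < 6 ∧ d < 6 := by
  have hp : e.Perm [0, 1, 2, 3, 4, 5] := by
    rw [evenOrderings] at he
    rw [← List.mem_permutations', ← orderings]
    exact List.mem_of_mem_filter he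
  have hl := hp.length_eq
  match e, hl with
  | [a, b, c, d, e₄, e₅], _ =>
    refine ⟨a, b, c, d, e₄, e₅, rfl, ?_, ?_⟩
    · have : c ∈ [0, 1, 2, 3, 4, 5] := hp.subset (by simp)
      simp at this; omega
    · have : d ∈ [0, 1, 2, 3, 4, 5] := hp.subset (by simp)
      simp at this; omega

/-- The part of `agreementTerm l m e` attached to the pair `(i, j)`. -/
def agreementCoeff (m : List ℕ) (i j : ℕ) : List ℕ → ℕ
  | [_, _, c, d, e, f] => bif c.beq i && d.beq j then entryLT m e f else 0
  | _ => 0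

lemma packedCoeff_eq (i j : ℕ) : packedCoeff i j =
    packDigits 256 (fun m => (evenOrderings.map (agreementCoeff m i j)).sum) orderings := by
  rw [← sum_map_packDigits, packedCoeff]
  congr 1
  refine List.map_congr_left fun e he => ?_
  obtain ⟨a, b, c, d, e, f, rfl, -⟩ := exists_eq_of_mem_evenOrderings he
  simp only [agreementCoeff, packedEntryLT]
  cases (c.beq i && d.beq j) <;> simp [packDigits_zero]

lemma agreementTerm_eq_sum (l m : List ℕ) {e : List ℕ} (he : e ∈ evenOrderings) :
    ([0, 1, 2, 3, 4, 5].map fun i =>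
      ([0, 1, 2, 3, 4, 5].map fun j => entryLT l i j * agreementCoeff m i j e).sum).sum =
      agreementTerm l m e := by
  obtain ⟨a, b, c, d, e, f, rfl, hc, hd⟩ := exists_eq_of_mem_evenOrderings he
  interval_cases c <;> interval_cases d <;> simp [agreementCoeff, agreementTerm, natBeq_eq_decide]

lemma packedAgreement_eq (l : List ℕ) :
    packedAgreement l = packDigits 256 (agreement l) orderings := by
  simp only [packedAgreement, packedCoeff_eq, ← packDigits_const_mul, sum_map_packDigits]
  congr 1
  funext m
  simp only [agreement, ← List.sum_map_mul_left]
  have : evenOrderings.map (agreementTerm l m) = evenOrderings.map fun e =>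
      ([0, 1, 2, 3, 4, 5].map fun i =>
        ([0, 1, 2, 3, 4, 5].map fun j => entryLT l i j * agreementCoeff m i j e).sum).sum :=
    List.map_congr_left fun e he => (agreementTerm_eq_sum l m he).symm
  rw [this]
  simp only [List.map_cons, List.map_nil, List.sum_cons, List.sum_nil, List.sum_map_add, add_zero]

lemma agreementTerm_le_one (l m e : List ℕ) : agreementTerm l m e ≤ 1 := by
  have h : ∀ (l : List ℕ) (i j : ℕ), entryLT l i j ≤ 1 := fun l i j => by
    unfold entryLT; cases (l.getD i 0).blt (l.getD j 0) <;> simp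
  unfold agreementTerm
  split
  · exact Nat.mul_le_mul (h _ _ _) (h _ _ _)
  · simp

/-- Two orderings of six elements agree on at most `56` of the even orderings. -/
lemma agreement_le {l m : List ℕ} (hl : l ∈ orderings) (hm : m ∈ orderings) :
    agreement l m ≤ 56 := by
  have hb : ∀ m ∈ orderings, agreement l m + 71 < 256 := fun m _ => by
    have := List.sum_le_card_nsmul (evenOrderings.map (agreementTerm l m)) 1 (by
      simp only [List.mem_map]
      rintro _ ⟨e, -, rfl⟩
      exact agreementTerm_le_one l m e)
    simp only [List.length_map, length_evenOrderings, smul_eq_mul, mul_one] at this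
    have h' : agreement l m ≤ 180 := this
    omega
  have h := packedAgreement_land l hl
  rw [packedAgreement_eq] at h
  have := lt_of_land_packDigits_eq_zero 71 (agreement l) orderings hb h m hm
  omega

lemma orderings_nodup : orderings.Nodup := by
  rw [orderings]
  exact (List.permutations_perm_permutations' _).nodup_iff.1
    (List.nodup_permutations _ (by decide))

/-- The list of values of a permutation. -/
def permList (σ : Equiv.Perm (Fin 6)) : List ℕ := List.ofFn fun i => (σ i : ℕ)

lemma permList_injective : Function.Injective permList := fun σ τ h => by
  have := List.ofFn_injective h
  ext i
  exact congrFun this i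

lemma permList_mem (σ : Equiv.Perm (Fin 6)) : permList σ ∈ orderings := by
  rw [orderings]
  exact List.mem_permutations'.2 (σ.ofFn_comp_perm (fun i : Fin 6 => (i : ℕ)))

set_option maxRecDepth 100000 in
lemma length_orderings : orderings.length = 720 := by decide +kernel

lemma sum_permList (g : List ℕ → ℕ) :
    ∑ σ : Equiv.Perm (Fin 6), g (permList σ) = (orderings.map g).sum := by
  rw [← List.sum_toFinset g orderings_nodup]
  have : orderings.toFinset = Finset.univ.image permList := by
    symm
    apply Finset.eq_of_subset_of_card_le
    · intro l hl
      obtain ⟨σ, -, rfl⟩ := Finset.mem_image.1 hl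
      exact List.mem_toFinset.2 (permList_mem σ)
    · rw [List.toFinset_card_of_nodup orderings_nodup, length_orderings,
        Finset.card_image_of_injective _ permList_injective, Finset.card_univ,
        Fintype.card_perm, Fintype.card_fin]
      rfl
  rw [this, Finset.sum_image fun _ _ _ _ h => permList_injective h]

lemma evenInversions_foldr (f : ℕ → Bool) (l : List ℕ) (r : Bool) :
    ((bif l.foldr (fun b r => xor (f b) r) r then 1 else -1 : ℤ)) =
      (l.map fun b => if f b then (-1 : ℤ) else 1).prod * (bif r then 1 else -1) := by
  induction l with
  | nil => simp
  | cons b t ih =>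
    simp only [List.foldr_cons, List.map_cons, List.prod_cons, mul_assoc, ← ih]
    cases f b <;> cases t.foldr (fun b r => xor (f b) r) r <;> simp

lemma evenInversions_ofFn : ∀ {n : ℕ} (f : Fin n → ℕ), Function.Injective f →
    (bif evenInversions (List.ofFn f) then 1 else -1 : ℤ) =
      ∏ i, ∏ j ∈ Finset.Ioi i, if f i < f j then (1 : ℤ) else -1
  | 0, f, _ => by simp [evenInversions]
  | n + 1, f, hf => by
    rw [List.ofFn_succ, evenInversions, evenInversions_foldr, Fin.prod_univ_succ,
      evenInversions_ofFn (fun i => f i.succ) (hf.comp (Fin.succ_injective n))]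
    congr 1
    · rw [List.map_ofFn, List.prod_ofFn, Fin.Ioi_zero_eq_map, Finset.prod_map]
      refine Finset.prod_congr rfl fun i _ => ?_
      have : f i.succ ≠ f 0 := fun h => Fin.succ_ne_zero i (hf h)
      simp only [Function.comp, blt_eq_decide, decide_eq_true_eq, Fin.coe_succEmb]
      split_ifs <;> first | rfl | omega
    · refine Finset.prod_congr rfl fun i _ => ?_
      rw [← Fin.map_succEmb_Ioi, Finset.prod_map]
      rfl

lemma evenInversions_permList (σ : Equiv.Perm (Fin 6)) :
    evenInversions (permList σ) = true ↔ Equiv.Perm.sign σ = 1 := by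
  have h := evenInversions_ofFn (fun i => (σ i : ℕ)) fun i j h => σ.injective (Fin.ext h)
  have h2 := congrArg (fun u : ℤˣ => (u : ℤ)) σ.sign_eq_prod_prod_Ioi
  simp only [Units.coe_prod] at h2
  have h3 : ((Equiv.Perm.sign σ : ℤˣ) : ℤ) =
      (bif evenInversions (permList σ) then 1 else -1 : ℤ) := by
    rw [permList, h, h2]
    refine Finset.prod_congr rfl fun i _ => Finset.prod_congr rfl fun j _ => ?_
    simp only [Fin.lt_def]
    split_ifs <;> rfl
  rw [← Units.val_inj, h3]
  cases evenInversions (permList σ) <;> simp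

/-- The indicator of `q i < q j`. -/
def ascent {n : ℕ} (q : Equiv.Perm (Fin n)) (i j : Fin n) : ℤ := if q i < q j then 1 else 0

lemma entryLT_permList (q : Equiv.Perm (Fin 6)) (i j : Fin 6) :
    (entryLT (permList q) i j : ℤ) = ascent q i j := by
  have h : ∀ i : Fin 6, (permList q).getD i 0 = q i := fun i => by
    rw [List.getD_eq_getElem _ _ (by simp [permList])]
    simp only [permList, List.getElem_ofFn]
  simp only [entryLT, h, blt_eq_decide, ascent, Fin.lt_def]
  by_cases h : (q i : ℕ) < q j <;> simp [h]

/-- `agreement`, written as a sum over permutations. -/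
lemma agreement_permList (q r : Equiv.Perm (Fin 6)) :
    (agreement (permList q) (permList r) : ℤ) =
      ∑ σ : Equiv.Perm (Fin 6), if Equiv.Perm.sign σ = 1 then
        ascent 1 (σ 0) (σ 1) * ascent q (σ 2) (σ 3) * ascent r (σ 4) (σ 5) else 0 := by
  have : ∀ (p : List ℕ → Bool) (g : List ℕ → ℕ) (l : List (List ℕ)),
      ((l.filter p).map g).sum = (l.map fun e => bif p e then g e else 0).sum := by
    intro p g l
    induction l with
    | nil => rfl
    | cons e t ih => cases h : p e <;> simp [h, ih]
  rw [agreement, evenOrderings, this, ← sum_permList]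
  push_cast
  refine Finset.sum_congr rfl fun σ _ => ?_
  have hs : permList σ = [(σ 0 : ℕ), σ 1, σ 2, σ 3, σ 4, σ 5] := rfl
  have h1 := evenInversions_permList σ
  rw [if_congr h1.symm rfl rfl]
  rw [← entryLT_permList q, ← entryLT_permList r, hs]
  simp only [agreementTerm, blt_eq_decide, ascent, Equiv.Perm.one_apply, Fin.lt_def]
  by_cases ha : (σ 0 : ℕ) < σ 1 <;>
    cases evenInversions [(σ 0 : ℕ), σ 1, σ 2, σ 3, σ 4, σ 5] <;> simp [ha]

lemma sum_even_ascent_le (q r : Equiv.Perm (Fin 6)) :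
    (∑ σ : Equiv.Perm (Fin 6), if Equiv.Perm.sign σ = 1 then
      ascent 1 (σ 0) (σ 1) * ascent q (σ 2) (σ 3) * ascent r (σ 4) (σ 5) else 0) ≤ 56 := by
  rw [← agreement_permList]
  exact_mod_cast agreement_le (permList_mem q) (permList_mem r)

/-- The first of two permutations at which the bound is attained. -/
def extremalPerm₁ : Equiv.Perm (Fin 6) := ⟨![1, 3, 5, 0, 2, 4], ![3, 0, 4, 1, 5, 2],
  by decide, by decide⟩

/-- The second of two permutations at which the bound is attained. -/
def extremalPerm₂ : Equiv.Perm (Fin 6) := ⟨![2, 5, 1, 4, 0, 3], ![4, 2, 0, 5, 3, 1],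
  by decide, by decide⟩

set_option maxRecDepth 100000 in
lemma agreement_extremal :
    agreement [1, 3, 5, 0, 2, 4] [2, 5, 1, 4, 0, 3] = 56 := by decide +kernel

lemma sum_even_ascent_extremal :
    (∑ σ : Equiv.Perm (Fin 6), if Equiv.Perm.sign σ = 1 then
      ascent 1 (σ 0) (σ 1) * ascent extremalPerm₁ (σ 2) (σ 3) *
        ascent extremalPerm₂ (σ 4) (σ 5) else 0) = 56 := by
  have h₁ : permList extremalPerm₁ = [1, 3, 5, 0, 2, 4] := rfl
  have h₂ : permList extremalPerm₂ = [2, 5, 1, 4, 0, 3] := rfl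
  rw [← agreement_permList, h₁, h₂, agreement_extremal]
  rfl

/-- The order relation between two elements, as a sign. -/
def ordSign {α : Type*} [LinearOrder α] (a b : α) : ℤ :=
  if a < b then 1 else if b < a then -1 else 0

lemma ordSign_swap {α : Type*} [LinearOrder α] (a b : α) : ordSign b a = -ordSign a b := by
  unfold ordSign
  rcases lt_trichotomy a b with h | rfl | h
  · simp [h, h.not_gt]
  · simp
  · simp [h, h.not_gt]

lemma ordSign_perm {n : ℕ} (q : Equiv.Perm (Fin n)) (i j : Fin n) :
    ordSign (q i) (q j) = ascent q i j - ascent q j i := by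
  unfold ordSign ascent
  rcases lt_trichotomy (q i) (q j) with h | h | h
  · simp [h, h.not_gt]
  · simp [h]
  · simp [h, h.not_gt]

/-- The sum over all permutations `σ`, weighted by `w`, of a product of three functions of two
values of `σ` each. -/
def pairSum {n : ℕ} (w : Equiv.Perm (Fin n) →* ℤˣ) (s₁ s₂ s₃ : Fin n → Fin n → ℤ)
    (i j k l m p : Fin n) : ℤ :=
  ∑ σ : Equiv.Perm (Fin n), (w σ : ℤ) * (s₁ (σ i) (σ j) * s₂ (σ k) (σ l) * s₃ (σ m) (σ p))

section pairSum

variable {n : ℕ} (w : Equiv.Perm (Fin n) →* ℤˣ) (s₁ s₂ s₃ : Fin n → Fin n → ℤ)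

lemma pairSum_comp (τ : Equiv.Perm (Fin n)) (i j k l m p : Fin n) :
    pairSum w s₁ s₂ s₃ (τ i) (τ j) (τ k) (τ l) (τ m) (τ p) =
      w τ * pairSum w s₁ s₂ s₃ i j k l m p := by
  unfold pairSum
  rw [Finset.mul_sum, eq_comm, ← Equiv.sum_comp (Equiv.mulRight τ)]
  refine Finset.sum_congr rfl fun σ _ => ?_
  simp only [Equiv.coe_mulRight, map_mul, Units.val_mul, Equiv.Perm.mul_apply]
  have : ((w τ : ℤˣ) : ℤ) * (w τ : ℤˣ) = 1 := by rw [← Units.val_mul, Int.units_mul_self]; rfl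
  linear_combination ((w σ : ℤ) * (s₁ (σ (τ i)) (σ (τ j)) * s₂ (σ (τ k)) (σ (τ l)) *
    s₃ (σ (τ m)) (σ (τ p)))) * this

lemma pairSum_sign_eq_zero {u v : Fin n} (huv : u ≠ v) {i j k l m p : Fin n}
    (h : ∀ x ∈ [i, j, k, l, m, p], Equiv.swap u v x = x) :
    pairSum Equiv.Perm.sign s₁ s₂ s₃ i j k l m p = 0 := by
  have := pairSum_comp Equiv.Perm.sign s₁ s₂ s₃ (Equiv.swap u v) i j k l m p
  simp only [List.mem_cons, List.not_mem_nil, or_false, forall_eq_or_imp, forall_eq] at h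
  obtain ⟨hi, hj, hk, hl, hm, hp⟩ := h
  rw [hi, hj, hk, hl, hm, hp, Equiv.Perm.sign_swap huv] at this
  simp only [Units.val_neg, Units.val_one] at this
  linarith

end pairSum

/-- The alternating sum over seven letters in the definition of `Theta`, with the orientation
cocycles of the three circles replaced by arbitrary functions. -/
def alternatingSum (o₁ o₂ o₃ : Fin 7 → Fin 7 → Fin 7 → ℤ) : ℤ :=
  ∑ σ : Equiv.Perm (Fin 7), (Equiv.Perm.sign σ : ℤ) *
    (o₁ (σ 0) (σ 1) (σ 2) * o₂ (σ 2) (σ 3) (σ 4) * o₃ (σ 4) (σ 5) (σ 6))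

/-- The function on triples whose value at `a, b, c` is the sum of `s` around this triangle. -/
def coboundary (s : Fin 7 → Fin 7 → ℤ) (a b c : Fin 7) : ℤ := s a b + s b c + s c a

lemma alternatingSum_coboundary (s₁ s₂ s₃ : Fin 7 → Fin 7 → ℤ) :
    alternatingSum (coboundary s₁) (coboundary s₂) (coboundary s₃) =
      7 * pairSum Equiv.Perm.sign s₁ s₂ s₃ 1 2 3 4 5 6 := by
  have hexp : alternatingSum (coboundary s₁) (coboundary s₂) (coboundary s₃) =
      (([(0, 1), (1, 2), (2, 0)] : List (Fin 7 × Fin 7)).map fun x =>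
        (([(2, 3), (3, 4), (4, 2)] : List (Fin 7 × Fin 7)).map fun y =>
          (([(4, 5), (5, 6), (6, 4)] : List (Fin 7 × Fin 7)).map fun z =>
            pairSum Equiv.Perm.sign s₁ s₂ s₃ x.1 x.2 y.1 y.2 z.1 z.2).sum).sum).sum := by
    simp only [alternatingSum, coboundary, pairSum, List.map_cons, List.map_nil, List.sum_cons,
      List.sum_nil, add_zero, ← Finset.sum_add_distrib]
    exact Finset.sum_congr rfl fun σ _ => by ring
  have hzero : ∀ {i j k l m p : Fin 7}, (∃ u v : Fin 7, u ≠ v ∧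
      ∀ x ∈ [i, j, k, l, m, p], Equiv.swap u v x = x) →
      pairSum Equiv.Perm.sign s₁ s₂ s₃ i j k l m p = 0 := by
    rintro i j k l m p ⟨u, v, huv, h⟩
    exact pairSum_sign_eq_zero s₁ s₂ s₃ huv h
  have hone : ∀ τ : Equiv.Perm (Fin 7), Equiv.Perm.sign τ = 1 →
      pairSum Equiv.Perm.sign s₁ s₂ s₃ (τ 1) (τ 2) (τ 3) (τ 4) (τ 5) (τ 6) =
        pairSum Equiv.Perm.sign s₁ s₂ s₃ 1 2 3 4 5 6 := by
    intro τ hτ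
    rw [pairSum_comp, hτ, Units.val_one, one_mul]
  have h6 := hone ⟨![6, 0, 1, 2, 3, 4, 5], ![1, 2, 3, 4, 5, 6, 0], by decide, by decide⟩
    (by decide +kernel)
  have h5 := hone ⟨![5, 0, 1, 2, 3, 6, 4], ![1, 2, 3, 4, 6, 0, 5], by decide, by decide⟩
    (by decide +kernel)
  have h4 := hone ⟨![4, 0, 1, 2, 3, 5, 6], ![1, 2, 3, 4, 0, 5, 6], by decide, by decide⟩
    (by decide +kernel)
  have h3 := hone ⟨![3, 0, 1, 4, 2, 5, 6], ![1, 2, 4, 0, 3, 5, 6], by decide, by decide⟩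
    (by decide +kernel)
  have h2 := hone ⟨![2, 0, 1, 3, 4, 5, 6], ![1, 2, 0, 3, 4, 5, 6], by decide, by decide⟩
    (by decide +kernel)
  have h1 := hone ⟨![1, 2, 0, 3, 4, 5, 6], ![2, 0, 1, 3, 4, 5, 6], by decide, by decide⟩
    (by decide +kernel)
  simp only [Equiv.coe_fn_mk] at h1 h2 h3 h4 h5 h6
  change pairSum _ _ _ _ 0 1 2 3 4 5 = _ at h6
  change pairSum _ _ _ _ 0 1 2 3 6 4 = _ at h5
  change pairSum _ _ _ _ 0 1 2 3 5 6 = _ at h4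
  change pairSum _ _ _ _ 0 1 4 2 5 6 = _ at h3
  change pairSum _ _ _ _ 0 1 3 4 5 6 = _ at h2
  change pairSum _ _ _ _ 2 0 3 4 5 6 = _ at h1
  rw [hexp]
  simp only [List.map_cons, List.map_nil, List.sum_cons, List.sum_nil, add_zero]
  rw [h1, h2, h3, h4, h5, h6]
  simp (disch := decide +kernel) only [hzero]
  ring

/-- Extend a function on pairs from the positive elements of `Fin 7` by zero. -/
def extendZero (s : Fin 6 → Fin 6 → ℤ) (a b : Fin 7) : ℤ :=
  Fin.cases 0 (fun i => Fin.cases 0 (fun j => s i j) b) a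

lemma pairSum_extendZero (s₁ s₂ s₃ : Fin 6 → Fin 6 → ℤ) :
    pairSum Equiv.Perm.sign (extendZero s₁) (extendZero s₂) (extendZero s₃) 1 2 3 4 5 6 =
      pairSum Equiv.Perm.sign s₁ s₂ s₃ 0 1 2 3 4 5 := by
  have hsucc : ∀ (s : Fin 6 → Fin 6 → ℤ) i j, extendZero s i.succ j.succ = s i j :=
    fun _ _ _ => rfl
  have hl : ∀ (s : Fin 6 → Fin 6 → ℤ) b, extendZero s 0 b = 0 := fun _ _ => rfl
  have hr : ∀ (s : Fin 6 → Fin 6 → ℤ) a, extendZero s a 0 = 0 := fun s a => by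
    cases a using Fin.cases <;> rfl
  unfold pairSum
  rw [← Equiv.sum_comp Equiv.Perm.decomposeFin.symm, Fintype.sum_prod_type, Fin.sum_univ_succ,
    Finset.sum_eq_zero (s := Finset.univ (α := Fin 6)), add_zero]
  · refine Finset.sum_congr rfl fun e _ => ?_
    have h : ∀ x : Fin 6, Equiv.Perm.decomposeFin.symm (0, e) x.succ = (e x).succ := fun x => by
      simp
    have hs := fun (s : Fin 6 → Fin 6 → ℤ) (x y : Fin 6) =>
      (congrArg₂ (extendZero s) (h x) (h y)).trans (hsucc s (e x) (e y))
    have h₁ := hs s₁ 0 1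
    have h₂ := hs s₂ 2 3
    have h₃ := hs s₃ 4 5
    simp only [Fin.succ_zero_eq_one, Fin.succ_one_eq_two, Fin.reduceSucc] at h₁ h₂ h₃
    rw [h₁, h₂, h₃]
    simp
  · intro p _
    refine Finset.sum_eq_zero fun e _ => ?_
    set σ := Equiv.Perm.decomposeFin.symm (p.succ, e) with hσ
    obtain ⟨x, hx⟩ := σ.surjective 0
    have h0 : σ 0 = p.succ := by simp [hσ]
    fin_cases x
    · exact absurd (h0.symm.trans hx) (Fin.succ_ne_zero p)
    all_goals
      simp only [Fin.reduceFinMk] at hx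
      simp [hx, hl, hr]

section symmetrize

variable {n : ℕ} (w : Equiv.Perm (Fin n) →* ℤˣ) (s₁ s₂ s₃ : Fin n → Fin n → ℤ)
  {i j k l m p : Fin n}

lemma pairSum_symmetrize₁ (h : ∀ x ∈ [k, l, m, p], Equiv.swap i j x = x) :
    pairSum w (fun a b => s₁ a b + w (Equiv.swap i j) * s₁ b a) s₂ s₃ i j k l m p =
      2 * pairSum w s₁ s₂ s₃ i j k l m p := by
  have h' := pairSum_comp w s₁ s₂ s₃ (Equiv.swap i j) i j k l m p
  simp only [List.mem_cons, List.not_mem_nil, or_false, forall_eq_or_imp, forall_eq] at h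
  obtain ⟨hk, hl, hm, hp⟩ := h
  rw [hk, hl, hm, hp, Equiv.swap_apply_left, Equiv.swap_apply_right] at h'
  have hu : ((w (Equiv.swap i j) : ℤˣ) : ℤ) * (w (Equiv.swap i j) : ℤˣ) = 1 := by
    rw [← Units.val_mul, Int.units_mul_self]; rfl
  have : pairSum w (fun a b => s₁ a b + w (Equiv.swap i j) * s₁ b a) s₂ s₃ i j k l m p =
      pairSum w s₁ s₂ s₃ i j k l m p +
        w (Equiv.swap i j) * pairSum w s₁ s₂ s₃ j i k l m p := by
    simp only [pairSum, Finset.mul_sum, ← Finset.sum_add_distrib]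
    exact Finset.sum_congr rfl fun σ _ => by ring
  rw [this, h']
  linear_combination pairSum w s₁ s₂ s₃ i j k l m p * hu

lemma pairSum_rotate :
    pairSum w s₁ s₂ s₃ i j k l m p = pairSum w s₂ s₃ s₁ k l m p i j :=
  Finset.sum_congr rfl fun σ _ => by ring

end symmetrize

lemma pairSum_symmetrize (w : Equiv.Perm (Fin 6) →* ℤˣ) {ε : ℤ}
    (hw : ∀ i j, i ≠ j → (w (Equiv.swap i j) : ℤ) = ε) (s₁ s₂ s₃ : Fin 6 → Fin 6 → ℤ) :
    pairSum w (fun a b => s₁ a b + ε * s₁ b a) (fun a b => s₂ a b + ε * s₂ b a)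
      (fun a b => s₃ a b + ε * s₃ b a) 0 1 2 3 4 5 = 8 * pairSum w s₁ s₂ s₃ 0 1 2 3 4 5 := by
  have h₁ := fun t₂ t₃ => pairSum_symmetrize₁ w s₁ t₂ t₃ (i := 0) (j := 1) (k := 2) (l := 3)
    (m := 4) (p := 5) (by decide)
  have h₂ := fun t₂ t₃ => pairSum_symmetrize₁ w s₂ t₂ t₃ (i := 2) (j := 3) (k := 4) (l := 5)
    (m := 0) (p := 1) (by decide)
  have h₃ := fun t₂ t₃ => pairSum_symmetrize₁ w s₃ t₂ t₃ (i := 4) (j := 5) (k := 0) (l := 1)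
    (m := 2) (p := 3) (by decide)
  rw [hw _ _ (by decide)] at h₁ h₂ h₃
  rw [h₁, pairSum_rotate, h₂, pairSum_rotate, h₃, pairSum_rotate]
  ring

/-- The signs of the differences of the values of a permutation. -/
def orderSign {n : ℕ} (q : Equiv.Perm (Fin n)) (i j : Fin n) : ℤ := ordSign (q i) (q j)

lemma pairSum_orderSign (q₁ q₂ q₃ : Equiv.Perm (Fin 6)) :
    pairSum Equiv.Perm.sign (orderSign q₁) (orderSign q₂) (orderSign q₃) 0 1 2 3 4 5 =
      8 * pairSum Equiv.Perm.sign (ascent q₁) (ascent q₂) (ascent q₃) 0 1 2 3 4 5 := by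
  rw [← pairSum_symmetrize Equiv.Perm.sign (ε := -1) (fun i j h => by
    rw [Equiv.Perm.sign_swap h]; rfl)]
  congr <;> · funext a b; rw [orderSign, ordSign_perm]; ring

lemma pairSum_one_ascent (q₁ q₂ q₃ : Equiv.Perm (Fin 6)) :
    pairSum 1 (ascent q₁) (ascent q₂) (ascent q₃) 0 1 2 3 4 5 = 90 := by
  have h := pairSum_symmetrize 1 (ε := 1) (fun i j _ => rfl) (ascent q₁) (ascent q₂) (ascent q₃)
  have hq : ∀ (q σ : Equiv.Perm (Fin 6)) (i j : Fin 6), i ≠ j →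
      ascent q (σ i) (σ j) + 1 * ascent q (σ j) (σ i) = 1 := fun q σ i j hij => by
    have : q (σ i) ≠ q (σ j) := fun h => hij (σ.injective (q.injective h))
    unfold ascent
    rcases lt_or_gt_of_ne this with h | h <;> simp [h, h.not_gt]
  have h1 : ∀ σ : Equiv.Perm (Fin 6), _ := fun σ => hq q₁ σ 0 1 (by decide)
  have h2 : ∀ σ : Equiv.Perm (Fin 6), _ := fun σ => hq q₂ σ 2 3 (by decide)
  have h3 : ∀ σ : Equiv.Perm (Fin 6), _ := fun σ => hq q₃ σ 4 5 (by decide)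
  rw [pairSum] at h
  simp only [h1, h2, h3, MonoidHom.one_apply, Units.val_one, mul_one, Finset.sum_const,
    Finset.card_univ, Fintype.card_perm, Fintype.card_fin, Nat.factorial,
    nsmul_eq_mul] at h
  norm_num at h
  linarith

lemma two_mul_sum_even_ascent (q r : Equiv.Perm (Fin 6)) :
    2 * (∑ σ : Equiv.Perm (Fin 6), if Equiv.Perm.sign σ = 1 then
      ascent 1 (σ 0) (σ 1) * ascent q (σ 2) (σ 3) * ascent r (σ 4) (σ 5) else 0) =
      pairSum Equiv.Perm.sign (ascent 1) (ascent q) (ascent r) 0 1 2 3 4 5 + 90 := by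
  rw [← pairSum_one_ascent 1 q r, Finset.mul_sum, pairSum, pairSum, ← Finset.sum_add_distrib]
  refine Finset.sum_congr rfl fun σ _ => ?_
  rcases Int.units_eq_one_or (Equiv.Perm.sign σ) with h | h
  · simp [h]; ring
  · simp [h]

lemma pairSum_orderSign_le (q r : Equiv.Perm (Fin 6)) :
    pairSum Equiv.Perm.sign (orderSign 1) (orderSign q) (orderSign r) 0 1 2 3 4 5 ≤ 176 := by
  have h₁ := two_mul_sum_even_ascent q r
  have h₂ := sum_even_ascent_le q r
  rw [pairSum_orderSign]
  linarith

lemma abs_pairSum_orderSign_le (q r : Equiv.Perm (Fin 6)) :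
    |pairSum Equiv.Perm.sign (orderSign 1) (orderSign q) (orderSign r) 0 1 2 3 4 5| ≤ 176 := by
  refine abs_le.2 ⟨?_, pairSum_orderSign_le q r⟩
  have h := pairSum_orderSign_le q (Fin.revPerm * r)
  have hrev : orderSign (Fin.revPerm * r) = fun i j => -orderSign r i j := by
    funext i j
    rw [orderSign, orderSign, ← ordSign_swap]
    simp [ordSign]
  have : pairSum Equiv.Perm.sign (orderSign 1) (orderSign q) (orderSign (Fin.revPerm * r))
      0 1 2 3 4 5 =
      -pairSum Equiv.Perm.sign (orderSign 1) (orderSign q) (orderSign r) 0 1 2 3 4 5 := by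
    simp only [hrev, pairSum, mul_neg, Finset.sum_neg_distrib]
  linarith

lemma pairSum_orderSign_extremal :
    pairSum Equiv.Perm.sign (orderSign 1) (orderSign extremalPerm₁) (orderSign extremalPerm₂)
      0 1 2 3 4 5 = 176 := by
  have h := two_mul_sum_even_ascent extremalPerm₁ extremalPerm₂
  rw [sum_even_ascent_extremal] at h
  rw [pairSum_orderSign]
  linarith

/-- The orientation of the triple of values of `r` at `a, b, c`. -/
def cyclicSign (r : Equiv.Perm (Fin 7)) : Fin 7 → Fin 7 → Fin 7 → ℤ := coboundary (orderSign r)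

lemma cyclicSign_subRight (r : Equiv.Perm (Fin 7)) (t : Fin 7) :
    cyclicSign ((Equiv.subRight t) * r) = cyclicSign r := by
  have h : ∀ t a b c : Fin 7, ordSign (a - t) (b - t) + ordSign (b - t) (c - t) +
      ordSign (c - t) (a - t) = ordSign a b + ordSign b c + ordSign c a := by
    simp only [ordSign]
    decide +kernel
  funext a b c
  exact h t (r a) (r b) (r c)

/-- The permutation of `0, …, 6` fixing `0` and acting as `q` on the other elements. -/
def fixZero (q : Equiv.Perm (Fin 6)) : Equiv.Perm (Fin 7) := Equiv.Perm.decomposeFin.symm (0, q)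

lemma cyclicSign_fixZero (q : Equiv.Perm (Fin 6)) :
    cyclicSign (fixZero q) = coboundary (extendZero (orderSign q)) := by
  have h0 : fixZero q 0 = 0 := by simp [fixZero]
  have hs : ∀ i : Fin 6, fixZero q i.succ = (q i).succ := fun i => by simp [fixZero]
  funext a b c
  simp only [cyclicSign, coboundary, orderSign]
  cases a using Fin.cases <;> cases b using Fin.cases <;> cases c using Fin.cases <;>
    simp [h0, hs, extendZero, ordSign, orderSign]

lemma exists_cyclicSign_eq (r : Equiv.Perm (Fin 7)) : ∃ q : Equiv.Perm (Fin 6),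
    cyclicSign r = coboundary (extendZero (orderSign q)) := by
  obtain ⟨⟨p, q⟩, hq⟩ := Equiv.Perm.decomposeFin.symm.surjective (Equiv.subRight (r 0) * r)
  have hp : p = 0 := by
    have := Equiv.congr_fun hq 0
    simpa using this
  subst hp
  exact ⟨q, by rw [← cyclicSign_subRight r (r 0), ← hq, ← cyclicSign_fixZero, fixZero]⟩

lemma alternatingSum_cyclicSign_mul (r₁ r₂ r₃ τ : Equiv.Perm (Fin 7)) :
    alternatingSum (cyclicSign (r₁ * τ)) (cyclicSign (r₂ * τ)) (cyclicSign (r₃ * τ)) =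
      Equiv.Perm.sign τ * alternatingSum (cyclicSign r₁) (cyclicSign r₂) (cyclicSign r₃) := by
  unfold alternatingSum
  rw [Finset.mul_sum, eq_comm, ← Equiv.sum_comp (Equiv.mulLeft τ)]
  refine Finset.sum_congr rfl fun σ _ => ?_
  have : ((Equiv.Perm.sign τ : ℤˣ) : ℤ) * (Equiv.Perm.sign τ : ℤˣ) = 1 := by
    rw [← Units.val_mul, Int.units_mul_self]; rfl
  simp only [Equiv.coe_mulLeft, map_mul, Units.val_mul, cyclicSign, coboundary, orderSign,
    Equiv.Perm.mul_apply]
  simp only [← mul_assoc, this, one_mul]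

lemma alternatingSum_extendZero (q₁ q₂ q₃ : Equiv.Perm (Fin 6)) :
    alternatingSum (coboundary (extendZero (orderSign q₁))) (coboundary (extendZero (orderSign q₂)))
      (coboundary (extendZero (orderSign q₃))) =
      7 * pairSum Equiv.Perm.sign (orderSign q₁) (orderSign q₂) (orderSign q₃) 0 1 2 3 4 5 := by
  rw [alternatingSum_coboundary, pairSum_extendZero]

lemma abs_alternatingSum_cyclicSign_le (r₁ r₂ r₃ : Equiv.Perm (Fin 7)) :
    |alternatingSum (cyclicSign r₁) (cyclicSign r₂) (cyclicSign r₃)| ≤ 1232 := by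
  have h := alternatingSum_cyclicSign_mul 1 (r₂ * r₁⁻¹) (r₃ * r₁⁻¹) r₁
  simp only [one_mul, inv_mul_cancel_right] at h
  obtain ⟨q₂, h₂⟩ := exists_cyclicSign_eq (r₂ * r₁⁻¹)
  obtain ⟨q₃, h₃⟩ := exists_cyclicSign_eq (r₃ * r₁⁻¹)
  have h₁ : cyclicSign 1 = coboundary (extendZero (orderSign 1)) := by
    rw [← cyclicSign_fixZero]
    congr 1
    ext i
    cases i using Fin.cases <;> simp [fixZero]
  have hs : |((Equiv.Perm.sign r₁ : ℤˣ) : ℤ)| = 1 := by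
    rcases Int.units_eq_one_or (Equiv.Perm.sign r₁) with h | h <;> simp [h]
  rw [h, h₁, h₂, h₃, alternatingSum_extendZero, abs_mul, abs_mul, hs]
  have := abs_pairSum_orderSign_le q₂ q₃
  rw [abs_of_pos (by norm_num : (0 : ℤ) < 7)]
  linarith

lemma alternatingSum_extremal :
    alternatingSum (cyclicSign (fixZero 1)) (cyclicSign (fixZero extremalPerm₁))
      (cyclicSign (fixZero extremalPerm₂)) = 1232 := by
  rw [cyclicSign_fixZero, cyclicSign_fixZero, cyclicSign_fixZero, alternatingSum_extendZero,
    pairSum_orderSign_extremal]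
  norm_num

lemma btw_coe_iff_of_mem_Ico {a b c : ℝ} (ha : a ∈ Set.Ico (0 : ℝ) 1) (hb : b ∈ Set.Ico (0 : ℝ) 1)
    (hc : c ∈ Set.Ico (0 : ℝ) 1) : btw (a : S1) b c ↔
      (if a ≤ b then b else b + 1) ≤ (if a < c then c else c + 1) := by
  have h₁ : toIcoMod one_pos a b = if a ≤ b then b else b + 1 := by
    rw [toIcoMod_eq_iff]
    obtain ⟨ha₀, ha₁⟩ := ha
    obtain ⟨hb₀, hb₁⟩ := hb
    split_ifs with h
    · exact ⟨⟨h, by linarith⟩, 0, by simp⟩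
    · exact ⟨⟨by linarith, by linarith⟩, -1, by simp⟩
  have h₂ : toIocMod one_pos a c = if a < c then c else c + 1 := by
    rw [toIocMod_eq_iff]
    obtain ⟨ha₀, ha₁⟩ := ha
    obtain ⟨hc₀, hc₁⟩ := hc
    split_ifs with h
    · exact ⟨⟨h, by linarith⟩, 0, by simp⟩
    · exact ⟨⟨by linarith, by linarith⟩, -1, by simp⟩
  rw [← h₁, ← h₂]
  exact QuotientAddGroup.btw_coe_iff

lemma OrS1_coe {a b c : ℝ} (ha : a ∈ Set.Ico (0 : ℝ) 1) (hb : b ∈ Set.Ico (0 : ℝ) 1)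
    (hc : c ∈ Set.Ico (0 : ℝ) 1) : OrS1 a b c =
      ((ordSign a b + ordSign b c + ordSign c a : ℤ) : ℝ) := by
  rw [OrS1]
  simp only [sbtw_iff_not_btw, btw_coe_iff_of_mem_Ico ha hb hc, btw_coe_iff_of_mem_Ico hc hb ha,
    ordSign, not_le]
  have hlt : ∀ {u v : ℝ}, u ∈ Set.Ico (0 : ℝ) 1 → v ∈ Set.Ico (0 : ℝ) 1 → u < v + 1 :=
    fun hu hv => by linarith [hu.2, hv.1]
  have hab := hlt ha hb
  have hba := hlt hb ha
  have hbc := hlt hb hc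
  have hcb := hlt hc hb
  have hca := hlt hc ha
  have hac := hlt ha hc
  rcases lt_trichotomy a b with h | h | h <;> rcases lt_trichotomy b c with h' | h' | h' <;>
    rcases lt_trichotomy c a with h'' | h'' | h'' <;>
    first
    | (exfalso; linarith)
    | (try subst h
       try subst h'
       try subst h''
       simp [*, le_of_lt, not_lt_of_gt, not_le_of_gt])

lemma exists_perm_lt_iff {n : ℕ} {α : Type*} [LinearOrder α] {f : Fin n → α}
    (hf : Function.Injective f) : ∃ r : Equiv.Perm (Fin n), ∀ a b, r a < r b ↔ f a < f b := by
  have hm : StrictMono (f ∘ Tuple.sort f) :=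
    (Tuple.monotone_sort f).strictMono_of_injective (hf.comp (Equiv.injective _))
  refine ⟨(Tuple.sort f)⁻¹, fun a b => ?_⟩
  rw [← hm.lt_iff_lt]
  simp

/-- An ordering with ties is the average of two strict orderings. -/
lemma exists_perm_two_mul_ordSign {n : ℕ} (x : Fin n → ℝ) : ∃ r r' : Equiv.Perm (Fin n),
    ∀ a b, 2 * ordSign (x a) (x b) = orderSign r a b + orderSign r' a b := by
  obtain ⟨r, hr⟩ := exists_perm_lt_iff (f := fun a => toLex (x a, a))
    fun a b h => (Prod.ext_iff.1 (toLex.injective h)).2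
  obtain ⟨r', hr'⟩ := exists_perm_lt_iff (f := fun a => toLex (x a, Fin.rev a))
    fun a b h => Fin.rev_injective (Prod.ext_iff.1 (toLex.injective h)).2
  refine ⟨r, r', fun a b => ?_⟩
  simp only [orderSign, ordSign, hr, hr', Prod.Lex.toLex_lt_toLex, Fin.rev_lt_rev]
  rcases lt_trichotomy (x a) (x b) with h | h | h
  · simp [h, h.ne]
  · rcases lt_trichotomy a b with h' | rfl | h'
    · simp [h, h', h'.not_gt]
    · simp
    · simp [h, h', h'.not_gt]
  · simp [h, h.not_gt, h.ne']

/-- The orientation of the triple of values of `x` at `a, b, c`. -/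
def realCyclicSign (x : Fin 7 → ℝ) : Fin 7 → Fin 7 → Fin 7 → ℤ :=
  coboundary fun a b => ordSign (x a) (x b)

lemma exists_perm_two_mul_realCyclicSign (x : Fin 7 → ℝ) : ∃ r r' : Equiv.Perm (Fin 7),
    ∀ a b c, 2 * realCyclicSign x a b c = cyclicSign r a b c + cyclicSign r' a b c := by
  obtain ⟨r, r', h⟩ := exists_perm_two_mul_ordSign x
  refine ⟨r, r', fun a b c => ?_⟩
  simp only [realCyclicSign, cyclicSign, coboundary, mul_add, h]
  ring

lemma abs_alternatingSum_realCyclicSign_le (x y z : Fin 7 → ℝ) :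
    |alternatingSum (realCyclicSign x) (realCyclicSign y) (realCyclicSign z)| ≤ 1232 := by
  obtain ⟨r, r', hr⟩ := exists_perm_two_mul_realCyclicSign x
  obtain ⟨s, s', hs⟩ := exists_perm_two_mul_realCyclicSign y
  obtain ⟨t, t', ht⟩ := exists_perm_two_mul_realCyclicSign z
  have h : 8 * alternatingSum (realCyclicSign x) (realCyclicSign y) (realCyclicSign z) =
      (([r, r'].map fun r => ([s, s'].map fun s => ([t, t'].map fun t =>
        alternatingSum (cyclicSign r) (cyclicSign s) (cyclicSign t)).sum).sum).sum) := by
    simp only [alternatingSum, List.map_cons, List.map_nil, List.sum_cons, List.sum_nil, add_zero,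
      ← Finset.sum_add_distrib, Finset.mul_sum]
    refine Finset.sum_congr rfl fun σ _ => ?_
    have e : ∀ u a b c : ℤ, 8 * (u * (a * b * c)) = u * ((2 * a) * (2 * b) * (2 * c)) := by
      intros; ring
    rw [e, hr, hs, ht]
    ring
  simp only [List.map_cons, List.map_nil, List.sum_cons, List.sum_nil, add_zero] at h
  have hb := fun r s t => abs_le.1 (abs_alternatingSum_cyclicSign_le r s t)
  rw [abs_le]
  constructor <;>
    linarith [hb r s t, hb r s t', hb r s' t, hb r s' t', hb r' s t, hb r' s t', hb r' s' t,
      hb r' s' t']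

lemma Theta_coe {x y z : Fin 7 → ℝ} (hx : ∀ a, x a ∈ Set.Ico (0 : ℝ) 1)
    (hy : ∀ a, y a ∈ Set.Ico (0 : ℝ) 1) (hz : ∀ a, z a ∈ Set.Ico (0 : ℝ) 1) :
    Theta (fun a => ((x a : S1), (y a : S1), (z a : S1))) =
      (alternatingSum (realCyclicSign x) (realCyclicSign y) (realCyclicSign z) : ℤ) / 5040 := by
  simp only [Theta, alternatingSum, OrS1_coe (hx _) (hx _) (hx _), OrS1_coe (hy _) (hy _) (hy _),
    OrS1_coe (hz _) (hz _) (hz _), realCyclicSign, coboundary]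
  push_cast
  norm_num [Nat.factorial]
  ring

lemma exists_coe_eq (u : S1) : ∃ x ∈ Set.Ico (0 : ℝ) 1, (x : S1) = u := by
  have h := (AddCircle.equivIco (1 : ℝ) 0 u).2
  exact ⟨_, by simpa only [zero_add] using h, AddCircle.coe_equivIco⟩

lemma abs_Theta_le (θ : Fin 7 → T3) : |Theta θ| ≤ 11 / 45 := by
  choose x hx hx' using fun a => exists_coe_eq (θ a).1
  choose y hy hy' using fun a => exists_coe_eq (θ a).2.1
  choose z hz hz' using fun a => exists_coe_eq (θ a).2.2
  have hθ : θ = fun a => ((x a : S1), (y a : S1), (z a : S1)) := by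
    funext a
    rw [hx', hy', hz']
  rw [hθ, Theta_coe hx hy hz, abs_div, ← Int.cast_abs]
  have h : ((|alternatingSum (realCyclicSign x) (realCyclicSign y) (realCyclicSign z)| : ℤ) : ℝ) ≤
      1232 := by exact_mod_cast abs_alternatingSum_realCyclicSign_le x y z
  rw [abs_of_pos (by norm_num : (0 : ℝ) < 5040), div_le_iff₀ (by norm_num)]
  linarith

lemma realCyclicSign_perm (r : Equiv.Perm (Fin 7)) :
    realCyclicSign (fun a => ((r a : ℕ) : ℝ) / 7) = cyclicSign r := by
  have h : ∀ a b : Fin 7, ((a : ℕ) : ℝ) / 7 < ((b : ℕ) : ℝ) / 7 ↔ a < b := fun a b => by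
    rw [div_lt_div_iff_of_pos_right (by norm_num), Nat.cast_lt, Fin.lt_def]
  simp only [realCyclicSign, cyclicSign, ordSign, h]
  rfl

/-- The supremum of `|Θ|` over all 7-tuples of points of `T³` equals `11/45`,
and it is attained. -/
theorem abs_Theta_isGreatest :
    IsGreatest (Set.range fun θ : Fin 7 → T3 => |Theta θ|) (11 / 45) := by
  refine ⟨?_, by rintro _ ⟨θ, rfl⟩; exact abs_Theta_le θ⟩
  have hmem : ∀ (r : Equiv.Perm (Fin 7)) (a : Fin 7),
      ((r a : ℕ) : ℝ) / 7 ∈ Set.Ico (0 : ℝ) 1 := fun r a => by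
    have : ((r a : ℕ) : ℝ) < 7 := by exact_mod_cast (r a).is_lt
    exact ⟨by positivity, by linarith⟩
  refine ⟨_, (congrArg abs (Theta_coe (hmem (fixZero 1)) (hmem (fixZero extremalPerm₁))
    (hmem (fixZero extremalPerm₂)))).trans ?_⟩
  simp only [realCyclicSign_perm, alternatingSum_extremal]
  norm_num
end
end

section
/- Let θⱼ = ([j/7], [2j/7], [3j/7]) ∈ T³ for j = 0,…,6, where [t] denotes the class of t ∈ ℝ in S¹ = ℝ/ℤ. Then Θ(θ₀,…,θ₆) = 11/45. -/
open scoped BigOperators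
open scoped Classical

noncomputable section

/-- The alternating sum of `G` over all rearrangements of the family `v`, in a form suited to
evaluation: expand according to the first entry of the rearrangement. -/
def altSum {α : Type*} : (n : ℕ) → (Fin n → α) → ((Fin n → α) → ℤ) → ℤ
  | 0, v, G => G v
  | n + 1, v, G => ∑ p : Fin (n + 1), (if p = 0 then 1 else -1) *
      altSum n (fun i => if i.succ = p then v 0 else v i.succ) (fun w => G (Fin.cons (v p) w))

theorem sum_sign_mul_eq_altSum {α : Type*} (n : ℕ) (v : Fin n → α) (G : (Fin n → α) → ℤ) :
    ∑ σ : Equiv.Perm (Fin n), (Equiv.Perm.sign σ : ℤ) * G (v ∘ σ) = altSum n v G := by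
  induction n with
  | zero => simp [altSum]
  | succ n ih =>
    rw [altSum, ← Equiv.Perm.decomposeFin.symm.sum_comp, Fintype.sum_prod_type]
    refine Finset.sum_congr rfl fun p _ => ?_
    rw [← ih, Finset.mul_sum]
    refine Finset.sum_congr rfl fun e _ => ?_
    rw [Equiv.Perm.decomposeFin.symm_sign, ← mul_assoc]
    congr 2
    · split_ifs <;> simp
    · funext i
      refine Fin.cases ?_ (fun i => ?_) i
      · simp
      · simp only [Function.comp, Equiv.Perm.decomposeFin_symm_apply_succ, Fin.cons_succ,
          Equiv.swap_apply_def, Fin.succ_ne_zero, if_false]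
        split_ifs <;> rfl

/-- Whether `a, b, c` are, up to cyclic rotation, strictly increasing. -/
def natCyclic (a b c : ℕ) : Bool :=
  (a.blt b && b.blt c) || (b.blt c && c.blt a) || (c.blt a && a.blt b)

/-- The orientation cocycle on natural numbers, for the cyclic order induced by `<`. -/
def natOr (a b c : ℕ) : ℤ :=
  if natCyclic a b c then 1 else if natCyclic c b a then -1 else 0

theorem natCyclic_iff {a b c : ℕ} :
    natCyclic a b c ↔ (a < b ∧ b < c) ∨ (b < c ∧ c < a) ∨ (c < a ∧ a < b) := by
  simp [natCyclic, Nat.blt_eq, or_assoc]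

theorem sbtw_coe_of_lt {x y z : ℝ} (hx : 0 ≤ x) (hxy : x < y) (hyz : y < z) (hz : z < 1) :
    sbtw (x : S1) (y : S1) (z : S1) := by
  have hy : toIcoMod (one_pos : (0 : ℝ) < 1) z y = y + 1 :=
    (toIcoMod_eq_iff _).2 ⟨⟨by linarith, by linarith⟩, -1, by simp⟩
  have hx' : toIocMod (one_pos : (0 : ℝ) < 1) z x = x + 1 :=
    (toIocMod_eq_iff _).2 ⟨⟨by linarith, by linarith⟩, -1, by simp⟩
  rw [sbtw_iff_not_btw]
  refine fun h => ?_
  have h' := QuotientAddGroup.btw_coe_iff.1 h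
  rw [hy, hx'] at h'
  linarith

theorem sbtw_natCast_div_iff {n a b c : ℕ} (ha : a < n) (hb : b < n) (hc : c < n) :
    sbtw (((a : ℝ) / n : ℝ) : S1) (((b : ℝ) / n : ℝ) : S1) (((c : ℝ) / n : ℝ) : S1) ↔
      natCyclic a b c := by
  have hn : (0 : ℝ) < n := by exact_mod_cast (Nat.zero_le a).trans_lt ha
  have key : ∀ {i j k : ℕ}, i < j → j < k → k < n →
      sbtw (((i : ℝ) / n : ℝ) : S1) (((j : ℝ) / n : ℝ) : S1) (((k : ℝ) / n : ℝ) : S1) := by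
    intro i j k hij hjk hk
    refine sbtw_coe_of_lt (by positivity) ?_ ?_ ?_
    · gcongr
    · gcongr
    · rw [div_lt_one hn]
      exact_mod_cast hk
  have of_cyclic : ∀ {i j k : ℕ}, i < n → j < n → k < n → natCyclic i j k →
      sbtw (((i : ℝ) / n : ℝ) : S1) (((j : ℝ) / n : ℝ) : S1) (((k : ℝ) / n : ℝ) : S1) := by
    intro i j k hi hj hk h
    rcases natCyclic_iff.1 h with h | h | h
    · exact key h.1 h.2 hk
    · exact (key h.1 h.2 hi).cyclic_right
    · exact (key h.1 h.2 hj).cyclic_left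
  refine ⟨fun h => ?_, of_cyclic ha hb hc⟩
  by_contra hcyc
  have hab : a ≠ b := by
    rintro rfl
    exact sbtw_irrefl_left h
  have hbc : b ≠ c := by
    rintro rfl
    exact sbtw_irrefl_right h
  have hac : a ≠ c := by
    rintro rfl
    exact sbtw_irrefl_left_right h
  have hcba : natCyclic c b a := by
    rw [natCyclic_iff] at hcyc ⊢
    omega
  exact sbtw_asymm h (of_cyclic hc hb ha hcba)

theorem OrS1_natCast_div {n a b c : ℕ} (ha : a < n) (hb : b < n) (hc : c < n) :
    OrS1 (((a : ℝ) / n : ℝ) : S1) (((b : ℝ) / n : ℝ) : S1) (((c : ℝ) / n : ℝ) : S1) =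
      natOr a b c := by
  simp only [OrS1, natOr, sbtw_natCast_div_iff ha hb hc, sbtw_natCast_div_iff hc hb ha]
  split_ifs <;> simp

theorem coe_natCast_div_eq_mod {n : ℕ} (hn : n ≠ 0) (m : ℕ) :
    (((m : ℝ) / n : ℝ) : S1) = (((m % n : ℕ) : ℝ) / n : ℝ) := by
  have hn' : (n : ℝ) ≠ 0 := by exact_mod_cast hn
  have h : (m : ℝ) / n = ((m % n : ℕ) : ℝ) / n + (m / n : ℕ) • (1 : ℝ) := by
    rw [nsmul_one, eq_comm, div_add' _ _ _ hn']
    congr 1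
    exact_mod_cast Nat.mod_add_div' m n
  rw [h, AddCircle.coe_add, AddCircle.coe_nsmul, AddCircle.coe_period, nsmul_zero, add_zero]

/-- The orientation of three multiples of `k / 7` on the circle. -/
def orMul (k : ℕ) (a b c : Fin 7) : ℤ :=
  natOr (k * a % 7) (k * b % 7) (k * c % 7)

theorem OrS1_mul_div_seven (k : ℕ) (a b c : Fin 7) :
    OrS1 (((k * (a : ℝ) / 7 : ℝ)) : S1) (((k * (b : ℝ) / 7 : ℝ)) : S1)
      (((k * (c : ℝ) / 7 : ℝ)) : S1) = orMul k a b c := by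
  have h (j : Fin 7) :
      (((k * (j : ℝ) / 7 : ℝ)) : S1) = (((k * j % 7 : ℕ) : ℝ) / (7 : ℕ) : ℝ) := by
    rw [← coe_natCast_div_eq_mod (by norm_num)]
    push_cast
    rfl
  rw [h, h, h, orMul]
  exact OrS1_natCast_div (Nat.mod_lt _ (by norm_num)) (Nat.mod_lt _ (by norm_num))
    (Nat.mod_lt _ (by norm_num))

set_option maxRecDepth 100000 in
theorem altSum_orMul :
    altSum 7 id (fun σ => orMul 1 (σ 0) (σ 1) (σ 2) * orMul 2 (σ 2) (σ 3) (σ 4) *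
      orMul 3 (σ 4) (σ 5) (σ 6)) = 1232 := by
  decide +kernel

/-- At the configuration `θⱼ = ([j/7], [2j/7], [3j/7])`, the cocycle `Θ` takes
the value `11/45`. -/
theorem Theta_apply_regular :
    Theta (fun j : Fin 7 =>
      (((((j : ℝ) / 7) : ℝ) : S1),
       ((((2 * (j : ℝ) / 7) : ℝ)) : S1),
       ((((3 * (j : ℝ) / 7) : ℝ)) : S1))) = 11 / 45 := by
  have h1 := OrS1_mul_div_seven 1
  have h2 := OrS1_mul_div_seven 2
  have h3 := OrS1_mul_div_seven 3
  simp only [Nat.cast_one, one_mul, Nat.cast_ofNat] at h1 h2 h3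
  have hsum := sum_sign_mul_eq_altSum 7 id (fun σ => orMul 1 (σ 0) (σ 1) (σ 2) *
    orMul 2 (σ 2) (σ 3) (σ 4) * orMul 3 (σ 4) (σ 5) (σ 6))
  rw [altSum_orMul] at hsum
  have hcast := congrArg (Int.cast : ℤ → ℝ) hsum
  simp only [Function.comp, id] at hcast
  push_cast at hcast
  simp only [Theta, h1, h2, h3]
  rw [hcast]
  norm_num [Nat.factorial]
end
end

section
/- Suppose (θ₀,…,θ₆) ∈ (T³)⁷ is such that the set {θ₀¹, θ₁¹, …, θ₆¹} consists of exactly 3 distinct points of S¹. Then |Θ(θ₀,…,θ₆)| < 11/45. -/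
open scoped BigOperators
open scoped Classical

noncomputable section

/-- The summand of `Theta`, read at the positions `i, j, k, l` in place of `3, 4, 5, 6`. -/
def thetaTerm (θ : Fin 7 → T3) (i j k l : Fin 7) (σ : Equiv.Perm (Fin 7)) : ℝ :=
  ((Equiv.Perm.sign σ : ℤ) : ℝ) *
    (OrS1 (θ (σ 0)).1 (θ (σ 1)).1 (θ (σ 2)).1 *
     OrS1 (θ (σ 2)).2.1 (θ (σ i)).2.1 (θ (σ j)).2.1 *
     OrS1 (θ (σ j)).2.2 (θ (σ k)).2.2 (θ (σ l)).2.2)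

lemma OrS1_rotate (a b c : S1) : OrS1 b c a = OrS1 a b c := by
  have h₁ : sbtw b c a ↔ sbtw a b c := sbtw_cyclic
  have h₂ : sbtw a c b ↔ sbtw c b a := sbtw_cyclic.symm
  simp only [OrS1, h₁, h₂]

lemma OrS1_reverse (a b c : S1) : OrS1 c b a = -OrS1 a b c := by
  have h : sbtw a b c → ¬ sbtw c b a := fun h => h.not_sbtw
  unfold OrS1
  split_ifs <;> simp_all

lemma OrS1_swap_right (a b c : S1) : OrS1 a c b = -OrS1 a b c := by
  rw [← OrS1_reverse, OrS1_rotate a c b]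

lemma OrS1_swap_left (a b c : S1) : OrS1 b a c = -OrS1 a b c := by
  rw [← OrS1_reverse, OrS1_rotate]

lemma OrS1_rotate' (a b c : S1) : OrS1 c a b = OrS1 a b c := by
  rw [OrS1_rotate b c a, OrS1_rotate]

lemma abs_OrS1_le_one (a b c : S1) : |OrS1 a b c| ≤ 1 := by
  unfold OrS1
  split_ifs <;> simp

lemma OrS1_self_left (a b : S1) : OrS1 a a b = 0 := by
  linarith [OrS1_swap_left a a b]

lemma OrS1_self_right (a b : S1) : OrS1 a b b = 0 := by
  linarith [OrS1_swap_right a b b]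

lemma OrS1_self_outer (a b : S1) : OrS1 a b a = 0 := by
  linarith [OrS1_reverse a b a]

lemma abs_sub_le_one_sub_mul {p q : ℝ} (hp : |p| ≤ 1) (hq : |q| ≤ 1) :
    |p - q| ≤ 1 - p * q := by
  rw [abs_le] at *
  constructor <;> nlinarith

/-- Four numbers in `[-1, 1]` have total pairwise distance at most `8`. -/
lemma sum_abs_sub_le_eight {p q r s : ℝ}
    (hp : |p| ≤ 1) (hq : |q| ≤ 1) (hr : |r| ≤ 1) (hs : |s| ≤ 1) :
    |p - q| + |p - r| + |p - s| + |q - r| + |q - s| + |r - s| ≤ 8 := by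
  have hp' := (sq_le_one_iff_abs_le_one p).2 hp
  have hq' := (sq_le_one_iff_abs_le_one q).2 hq
  have hr' := (sq_le_one_iff_abs_le_one r).2 hr
  have hs' := (sq_le_one_iff_abs_le_one s).2 hs
  linarith [abs_sub_le_one_sub_mul hp hq, abs_sub_le_one_sub_mul hp hr,
    abs_sub_le_one_sub_mul hp hs, abs_sub_le_one_sub_mul hq hr, abs_sub_le_one_sub_mul hq hs,
    abs_sub_le_one_sub_mul hr hs, sq_nonneg (p + q + r + s)]

/-- The sum over the even permutations of the last four positions. -/
def evenSum (θ : Fin 7 → T3) (σ : Equiv.Perm (Fin 7)) : ℝ :=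
  thetaTerm θ 3 4 5 6 σ +
  thetaTerm θ 3 5 6 4 σ +
  thetaTerm θ 3 6 4 5 σ +
  thetaTerm θ 4 3 6 5 σ +
  thetaTerm θ 4 5 3 6 σ +
  thetaTerm θ 4 6 5 3 σ +
  thetaTerm θ 5 3 4 6 σ +
  thetaTerm θ 5 4 6 3 σ +
  thetaTerm θ 5 6 3 4 σ +
  thetaTerm θ 6 3 5 4 σ +
  thetaTerm θ 6 4 3 5 σ +
  thetaTerm θ 6 5 4 3 σ

lemma abs_evenSum_le (θ : Fin 7 → T3) (σ : Equiv.Perm (Fin 7)) :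
    |evenSum θ σ| ≤ 8 * |OrS1 (θ (σ 0)).1 (θ (σ 1)).1 (θ (σ 2)).1| := by
  set t : Fin 7 → Fin 7 → ℝ := fun i j => OrS1 (θ (σ 2)).2.1 (θ (σ i)).2.1 (θ (σ j)).2.1 with ht
  set o : Fin 7 → Fin 7 → Fin 7 → ℝ :=
    fun i j k => OrS1 (θ (σ i)).2.2 (θ (σ j)).2.2 (θ (σ k)).2.2 with ho
  have ht_le (i j) : |t i j| ≤ 1 := abs_OrS1_le_one _ _ _
  have ho_le (i j k) : |o i j k| ≤ 1 := abs_OrS1_le_one _ _ _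
  have ht_symm (i j) : t j i = -t i j := OrS1_swap_right _ _ _
  have ho_rot (i j k) : o j k i = o i j k := OrS1_rotate _ _ _
  have ho_rot' (i j k) : o k i j = o i j k := OrS1_rotate' _ _ _
  have ho_swap (i j k) : o i k j = -o i j k := OrS1_swap_right _ _ _
  have ho_swap' (i j k) : o j i k = -o i j k := OrS1_swap_left _ _ _
  have ho_rev (i j k) : o k j i = -o i j k := OrS1_reverse _ _ _
  have hterm (i j k l : Fin 7) : thetaTerm θ i j k l σ = ((Equiv.Perm.sign σ : ℤ) : ℝ) *
      OrS1 (θ (σ 0)).1 (θ (σ 1)).1 (θ (σ 2)).1 * (t i j * o j k l) := by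
    simp only [thetaTerm, ht, ho]
    ring
  have key : evenSum θ σ = ((Equiv.Perm.sign σ : ℤ) : ℝ) *
      OrS1 (θ (σ 0)).1 (θ (σ 1)).1 (θ (σ 2)).1 *
      (t 3 4 * (o 4 5 6 - -o 3 5 6) + t 3 5 * (o 4 5 6 - o 3 4 6) +
        t 3 6 * (o 4 5 6 - -o 3 4 5) + t 4 5 * (-o 3 5 6 - o 3 4 6) +
        t 4 6 * (-o 3 5 6 - -o 3 4 5) + t 5 6 * (o 3 4 6 - -o 3 4 5)) := by
    simp only [evenSum, hterm, ht_symm 3 4, ht_symm 3 5, ht_symm 4 5, ht_symm 3 6, ht_symm 4 6,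
      ht_symm 5 6, ho_swap 3 4 5, ho_swap 3 5 6, ho_swap' 3 4 5, ho_rot 3 4 6, ho_swap' 3 5 6,
      ho_rev 3 4 5, ho_rot 4 5 6, ho_rot' 3 4 6, ho_rot' 4 5 6, ho_rev 3 5 6]
    ring
  have hsign : |((Equiv.Perm.sign σ : ℤ) : ℝ)| = 1 := by
    rcases Int.units_eq_one_or (Equiv.Perm.sign σ) with h | h <;> simp [h]
  rw [key, abs_mul, abs_mul, hsign, one_mul, mul_comm]
  refine mul_le_mul_of_nonneg_right ?_ (abs_nonneg _)
  have hmul (i j : Fin 7) (d : ℝ) : |t i j * d| ≤ |d| := by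
    rw [abs_mul]
    exact mul_le_of_le_one_left (abs_nonneg d) (ht_le i j)
  have hsum := sum_abs_sub_le_eight (ho_le 4 5 6) ((abs_neg (o 3 5 6)).trans_le (ho_le 3 5 6))
    (ho_le 3 4 6) ((abs_neg (o 3 4 5)).trans_le (ho_le 3 4 5))
  refine le_trans ?_ hsum
  refine (abs_add_le _ _).trans (add_le_add ?_ (hmul _ _ _))
  refine (abs_add_le _ _).trans (add_le_add ?_ (hmul _ _ _))
  refine (abs_add_le _ _).trans (add_le_add ?_ (hmul _ _ _))
  refine (abs_add_le _ _).trans (add_le_add ?_ (hmul _ _ _))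
  exact (abs_add_le _ _).trans (add_le_add (hmul _ _ _) (hmul _ _ _))

lemma sum_thetaTerm_eq (θ : Fin 7 → T3) (τ : Equiv.Perm (Fin 7))
    (h : Equiv.Perm.sign τ = 1 ∧ τ 0 = 0 ∧ τ 1 = 1 ∧ τ 2 = 2) :
    ∑ σ, thetaTerm θ (τ 3) (τ 4) (τ 5) (τ 6) σ = ∑ σ, thetaTerm θ 3 4 5 6 σ := by
  obtain ⟨hsign, h₀, h₁, h₂⟩ := h
  refine Fintype.sum_equiv (Equiv.mulRight τ) _ _ fun σ => ?_
  simp [thetaTerm, hsign, h₀, h₁, h₂]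

lemma sum_evenSum (θ : Fin 7 → T3) :
    ∑ σ, evenSum θ σ = 12 * ∑ σ, thetaTerm θ 3 4 5 6 σ := by
  have h (a b c d : Fin 7) (hab : a ≠ b) (hcd : c ≠ d)
      (hfix : 3 ≤ a ∧ 3 ≤ b ∧ 3 ≤ c ∧ 3 ≤ d) :=
    sum_thetaTerm_eq θ (Equiv.swap a b * Equiv.swap c d)
      ⟨by simp [Equiv.Perm.sign_swap hab, Equiv.Perm.sign_swap hcd], by
        have hx (x : Fin 7) (hx : x < 3) : (Equiv.swap a b * Equiv.swap c d) x = x := by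
          rw [Equiv.Perm.mul_apply, Equiv.swap_apply_of_ne_of_ne (a := c) (b := d),
            Equiv.swap_apply_of_ne_of_ne] <;> omega
        exact ⟨hx 0 (by decide), hx 1 (by decide), hx 2 (by decide)⟩⟩
  have h_3564 : ∑ σ, thetaTerm θ 3 5 6 4 σ = ∑ σ, thetaTerm θ 3 4 5 6 σ :=
    h 4 5 5 6 (by decide) (by decide) (by decide)
  have h_3645 : ∑ σ, thetaTerm θ 3 6 4 5 σ = ∑ σ, thetaTerm θ 3 4 5 6 σ :=
    h 4 5 4 6 (by decide) (by decide) (by decide)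
  have h_4365 : ∑ σ, thetaTerm θ 4 3 6 5 σ = ∑ σ, thetaTerm θ 3 4 5 6 σ :=
    h 3 4 5 6 (by decide) (by decide) (by decide)
  have h_4536 : ∑ σ, thetaTerm θ 4 5 3 6 σ = ∑ σ, thetaTerm θ 3 4 5 6 σ :=
    h 3 4 4 5 (by decide) (by decide) (by decide)
  have h_4653 : ∑ σ, thetaTerm θ 4 6 5 3 σ = ∑ σ, thetaTerm θ 3 4 5 6 σ :=
    h 3 4 4 6 (by decide) (by decide) (by decide)
  have h_5346 : ∑ σ, thetaTerm θ 5 3 4 6 σ = ∑ σ, thetaTerm θ 3 4 5 6 σ :=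
    h 3 4 3 5 (by decide) (by decide) (by decide)
  have h_5463 : ∑ σ, thetaTerm θ 5 4 6 3 σ = ∑ σ, thetaTerm θ 3 4 5 6 σ :=
    h 3 5 5 6 (by decide) (by decide) (by decide)
  have h_5634 : ∑ σ, thetaTerm θ 5 6 3 4 σ = ∑ σ, thetaTerm θ 3 4 5 6 σ :=
    h 3 5 4 6 (by decide) (by decide) (by decide)
  have h_6354 : ∑ σ, thetaTerm θ 6 3 5 4 σ = ∑ σ, thetaTerm θ 3 4 5 6 σ :=
    h 3 4 3 6 (by decide) (by decide) (by decide)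
  have h_6435 : ∑ σ, thetaTerm θ 6 4 3 5 σ = ∑ σ, thetaTerm θ 3 4 5 6 σ :=
    h 3 5 3 6 (by decide) (by decide) (by decide)
  have h_6543 : ∑ σ, thetaTerm θ 6 5 4 3 σ = ∑ σ, thetaTerm θ 3 4 5 6 σ :=
    h 3 6 4 5 (by decide) (by decide) (by decide)
  simp only [evenSum, Finset.sum_add_distrib]
  linarith

lemma exists_perm_apply_eq {i j k : Fin 7} (hij : i ≠ j) (hik : i ≠ k) (hjk : j ≠ k) :
    ∃ τ : Equiv.Perm (Fin 7), τ 0 = i ∧ τ 1 = j ∧ τ 2 = k := by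
  have hinj : Function.Injective ![i, j, k] := by
    intro a b hab
    fin_cases a <;> fin_cases b <;> simp_all [eq_comm]
  have hinj₀ : Function.Injective ![(0 : Fin 7), 1, 2] := by decide
  obtain ⟨τ, hτ⟩ := (Equiv.Perm.isMultiplyPretransitive (Fin 7) 3).exists_smul_eq
    ⟨_, hinj₀⟩ ⟨_, hinj⟩
  have h (a : Fin 3) := DFunLike.congr_fun hτ a
  exact ⟨τ, h 0, h 1, h 2⟩

/-- Each triple of distinct indices is `(σ 0, σ 1, σ 2)` for `4! = 24` permutations `σ`. -/
lemma sum_perm_eq (W : Fin 7 → Fin 7 → Fin 7 → ℝ)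
    (h₁ : ∀ i k, W i i k = 0) (h₂ : ∀ i k, W i k i = 0) (h₃ : ∀ i k, W i k k = 0) :
    ∑ σ : Equiv.Perm (Fin 7), W (σ 0) (σ 1) (σ 2) = 24 * ∑ i, ∑ j, ∑ k, W i j k := by
  set S := ∑ σ : Equiv.Perm (Fin 7), W (σ 0) (σ 1) (σ 2) with hS
  have hconst (i j k : Fin 7) : ∑ σ : Equiv.Perm (Fin 7), W (σ i) (σ j) (σ k) =
      if i ≠ j ∧ i ≠ k ∧ j ≠ k then S else 0 := by
    split_ifs with h
    · obtain ⟨τ, rfl, rfl, rfl⟩ := exists_perm_apply_eq h.1 h.2.1 h.2.2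
      exact Fintype.sum_equiv (Equiv.mulRight τ) _ _ fun σ => rfl
    · refine Finset.sum_eq_zero fun σ _ => ?_
      by_cases hij : i = j
      · subst hij; exact h₁ _ _
      by_cases hik : i = k
      · subst hik; exact h₂ _ _
      have hjk : j = k := by tauto
      subst hjk; exact h₃ _ _
  have hleft : ∑ i, ∑ j, ∑ k, ∑ σ : Equiv.Perm (Fin 7), W (σ i) (σ j) (σ k) = 210 * S := by
    have hcard : (Finset.univ.filter fun x : Fin 7 × Fin 7 × Fin 7 =>
        x.1 ≠ x.2.1 ∧ x.1 ≠ x.2.2 ∧ x.2.1 ≠ x.2.2).card = 210 := by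
      decide +kernel
    calc _ = ∑ x : Fin 7 × Fin 7 × Fin 7,
          if x.1 ≠ x.2.1 ∧ x.1 ≠ x.2.2 ∧ x.2.1 ≠ x.2.2 then S else 0 := by
          simp only [hconst, Fintype.sum_prod_type]
      _ = 210 * S := by
          rw [← Finset.sum_filter, Finset.sum_const, hcard, nsmul_eq_mul]
          norm_num
  have hright : ∑ i, ∑ j, ∑ k, ∑ σ : Equiv.Perm (Fin 7), W (σ i) (σ j) (σ k) =
      5040 * ∑ i, ∑ j, ∑ k, W i j k := by
    have hσ (σ : Equiv.Perm (Fin 7)) :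
        ∑ i, ∑ j, ∑ k, W (σ i) (σ j) (σ k) = ∑ i, ∑ j, ∑ k, W i j k := by
      rw [← Equiv.sum_comp σ fun i => ∑ j, ∑ k, W i j k]
      refine Finset.sum_congr rfl fun i _ => ?_
      rw [← Equiv.sum_comp σ fun j => ∑ k, W (σ i) j k]
      refine Finset.sum_congr rfl fun j _ => ?_
      exact Equiv.sum_comp σ _
    calc _ = ∑ σ : Equiv.Perm (Fin 7), ∑ i, ∑ j, ∑ k, W (σ i) (σ j) (σ k) := by
          simp only [Finset.sum_comm (t := (Finset.univ : Finset (Equiv.Perm (Fin 7))))]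
      _ = _ := by
          simp [hσ, Fintype.card_perm, Nat.factorial]
  linarith

/-- If `f` takes at most three values, their multiplicities have product at most `12`. -/
lemma sum_abs_OrS1_le {f : Fin 7 → S1} {p q r : S1} (hpq : p ≠ q) (hpr : p ≠ r) (hqr : q ≠ r)
    (hf : ∀ i, f i = p ∨ f i = q ∨ f i = r) :
    ∑ i, ∑ j, ∑ k, |OrS1 (f i) (f j) (f k)| ≤ 72 := by
  set A : S1 → Fin 7 → ℝ := fun x i => if f i = x then 1 else 0 with hA
  set N : S1 → ℕ := fun x => (Finset.univ.filter fun i => f i = x).card with hN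
  have hAN (x) : ∑ i, A x i = N x := by simp [hA, hN]
  have hprod (x y z : S1) :
      ∑ i, ∑ j, ∑ k, A x i * A y j * A z k = N x * N y * N z := by
    simp only [← Finset.mul_sum, ← Finset.sum_mul, hAN]
  have hle (i j k : Fin 7) : |OrS1 (f i) (f j) (f k)| ≤
      A p i * A q j * A r k + A p i * A r j * A q k + A q i * A p j * A r k +
      A q i * A r j * A p k + A r i * A p j * A q k + A r i * A q j * A p k := by
    have h := abs_OrS1_le_one
    rcases hf i with hi | hi | hi <;> rcases hf j with hj | hj | hj <;>
      rcases hf k with hk | hk | hk <;>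
      simp [hA, hi, hj, hk, h, hpq, hpr, hqr, hpq.symm, hpr.symm, hqr.symm, OrS1_self_left,
        OrS1_self_right, OrS1_self_outer]
  have hsum : N p + N q + N r = 7 := by
    have h (i) : A p i + A q i + A r i = 1 := by
      rcases hf i with hi | hi | hi <;>
        simp [hA, hi, hpq, hpr, hqr, hpq.symm, hpr.symm, hqr.symm]
    have h' : ∑ i, (A p i + A q i + A r i) = 7 := by simp [h]
    simp only [Finset.sum_add_distrib, hAN] at h'
    exact_mod_cast h'
  have hmul : N p * N q * N r ≤ 12 := by
    have h₁ : N p ≤ 7 := by omega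
    have h₂ : N q ≤ 7 := by omega
    have h₃ : N r = 7 - N p - N q := by omega
    rw [h₃]
    generalize N p = a at *
    generalize N q = b at *
    interval_cases a <;> interval_cases b <;> simp
  have hmul' : (N p * N q * N r : ℝ) ≤ 12 := by exact_mod_cast hmul
  calc _ ≤ ∑ i, ∑ j, ∑ k, (A p i * A q j * A r k + A p i * A r j * A q k +
      A q i * A p j * A r k + A q i * A r j * A p k + A r i * A p j * A q k +
      A r i * A q j * A p k) :=
        Finset.sum_le_sum fun i _ => Finset.sum_le_sum fun j _ => Finset.sum_le_sum fun k _ =>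
          hle i j k
    _ = 6 * (N p * N q * N r : ℝ) := by
        simp only [Finset.sum_add_distrib, hprod]
        ring
    _ ≤ 72 := by linarith

/-- If the first coordinates `θ₀¹,…,θ₆¹` take exactly 3 distinct values, then
`|Θ(θ₀,…,θ₆)| < 11/45`. -/
theorem abs_Theta_lt_of_three_distinct (θ : Fin 7 → T3)
    (h : (Set.range fun j => (θ j).1).ncard = 3) :
    |Theta θ| < 11 / 45 := by
  obtain ⟨p, q, r, hpq, hpr, hqr, hrange⟩ := Set.ncard_eq_three.1 h
  have hf (i) : (θ i).1 = p ∨ (θ i).1 = q ∨ (θ i).1 = r := by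
    have hi := Set.mem_range_self (f := fun j => (θ j).1) i
    rw [hrange] at hi
    simpa using hi
  have hcount : ∑ σ : Equiv.Perm (Fin 7),
      |OrS1 (θ (σ 0)).1 (θ (σ 1)).1 (θ (σ 2)).1| ≤ 1728 := by
    rw [sum_perm_eq fun i j k => |OrS1 (θ i).1 (θ j).1 (θ k).1|]
    · linarith [sum_abs_OrS1_le hpq hpr hqr hf]
    all_goals simp [OrS1_self_left, OrS1_self_right, OrS1_self_outer]
  have hbound : |∑ σ, thetaTerm θ 3 4 5 6 σ| ≤ 1152 := by
    have h₁ : |∑ σ, evenSum θ σ| ≤ 8 * 1728 :=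
      calc _ ≤ ∑ σ, |evenSum θ σ| := Finset.abs_sum_le_sum_abs _ _
        _ ≤ ∑ σ : Equiv.Perm (Fin 7), 8 * |OrS1 (θ (σ 0)).1 (θ (σ 1)).1 (θ (σ 2)).1| :=
          Finset.sum_le_sum fun σ _ => abs_evenSum_le θ σ
        _ ≤ 8 * 1728 := by rw [← Finset.mul_sum]; linarith
    rw [sum_evenSum, abs_mul, abs_of_pos (by norm_num)] at h₁
    linarith
  have hTheta : Theta θ = 1 / 5040 * ∑ σ, thetaTerm θ 3 4 5 6 σ := by
    simp [Theta, thetaTerm, Nat.factorial]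
  rw [hTheta, abs_mul, abs_of_pos (by norm_num)]
  linarith
end
end
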